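/- Let G = C(α_1,…,α_{2k}) be a C-graph with adjacency matrix A, and let α_min = min{α_1,…,α_{2k}}. Then every eigenvalue λ of A with λ < −1 satisfies λ < (−1−√2)/2, and every eigenvalue λ of A with λ > 0 satisfies λ > ((−1+√2)/2)·α_min. That is, λ^−(G) < (−1−√2)/2 and λ_+(G) > ((−1+√2)/2)·α_min, where λ^−(G) denotes the largest eigenvalue of G smaller than −1 and λ_+(G) the least positive eigenvalue of G (when they exist). -/

import Mathlib

open Matrix BigOperators
open scoped Classical

/-- The equivalence splitting off the last cell of `Σ j : Fin (m+1), Fin (α j)`. -/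
def splitLast (α : ℕ → ℕ) (m : ℕ) :
    (Σ j : Fin (m + 1), Fin (α j.val)) ≃ (Σ j : Fin m, Fin (α j.val)) ⊕ Fin (α m) where
  toFun x :=
    if h : x.1.val < m then Sum.inl ⟨⟨x.1.val, h⟩, x.2⟩
    else Sum.inr (Fin.cast (congrArg α
      (Nat.le_antisymm (Nat.lt_succ_iff.mp x.1.isLt) (Nat.le_of_not_lt h))) x.2)
  invFun x :=
    match x with
    | Sum.inl y => ⟨⟨y.1.val, Nat.lt_succ_of_lt y.1.isLt⟩, y.2⟩
    | Sum.inr a => ⟨⟨m, Nat.lt_succ_self m⟩, a⟩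
  left_inv := by
    rintro ⟨⟨jv, hj⟩, a⟩
    by_cases h : jv < m
    · simp [h]
    · have hm : jv = m := Nat.le_antisymm (Nat.lt_succ_iff.mp hj) (Nat.le_of_not_lt h)
      subst hm
      simp [h, Fin.cast]
  right_inv := by
    rintro (⟨⟨jv, hj⟩, a⟩ | a)
    · simp [hj]
    · simp [Fin.cast]

/-- The cograph `C(α 0, α 1, …, α (m-1))` (1-indexed in the paper: `C(α_1,…,α_m)`),
defined recursively: `C(α_1)` is the complement of the complete graph `K_{α_1}`, and
`C(α_1,…,α_i)` is the complement of the disjoint union of `C(α_1,…,α_{i-1})` and `K_{α_i}`.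
The vertices added at step `j` (the cell `C_j`) are the pairs `⟨j, a⟩`. -/
def cographC (α : ℕ → ℕ) : (m : ℕ) → SimpleGraph (Σ j : Fin m, Fin (α j.val))
  | 0 => ⊥
  | m + 1 =>
      SimpleGraph.comap (splitLast α m)
        ((cographC α m ⊕g (⊤ : SimpleGraph (Fin (α m))))ᶜ)

/-- The real adjacency matrix of a finite simple graph. -/
noncomputable def adjMat {V : Type*} [Fintype V] (G : SimpleGraph V) : Matrix V V ℝ :=
  Matrix.of fun u v => if G.Adj u v then (1 : ℝ) else 0

lemma cographC_adj_iff (α : ℕ → ℕ) (m : ℕ) (x y : Σ j : Fin m, Fin (α j.val)) :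
    (cographC α m).Adj x y ↔ x ≠ y ∧
      if x.1 = y.1 then Even (m + x.1.val) else Odd (m + max x.1.val y.1.val) := by
  induction m with
  | zero => exact x.1.elim0
  | succ m ih =>
    obtain ⟨x, rfl⟩ := (splitLast α m).symm.surjective x
    obtain ⟨y, rfl⟩ := (splitLast α m).symm.surjective y
    simp only [cographC, SimpleGraph.comap_adj, SimpleGraph.compl_adj, Equiv.apply_symm_apply,
      ne_eq, EmbeddingLike.apply_eq_iff_eq]
    rcases x with x | a <;> rcases y with y | b
    · have hx : ((splitLast α m).symm (Sum.inl x)).1.val = x.1.val := rfl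
      have hy : ((splitLast α m).symm (Sum.inl y)).1.val = y.1.val := rfl
      rw [SimpleGraph.sum_adj]
      simp only [ih, Fin.ext_iff, hx, hy, Sum.inl.injEq]
      by_cases hxy : x = y
      · simp [hxy]
      · split_ifs <;> grind
    · have hx : ((splitLast α m).symm (Sum.inl x)).1.val = x.1.val := rfl
      have hy : ((splitLast α m).symm (Sum.inr b)).1.val = m := rfl
      have := x.1.isLt
      rw [SimpleGraph.sum_adj]
      simp only [Fin.ext_iff, hx, hy]
      rw [if_neg (by omega), max_eq_right (by omega)]
      simp
    · have hx : ((splitLast α m).symm (Sum.inr a)).1.val = m := rfl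
      have hy : ((splitLast α m).symm (Sum.inl y)).1.val = y.1.val := rfl
      have := y.1.isLt
      rw [SimpleGraph.sum_adj]
      simp only [Fin.ext_iff, hx, hy]
      rw [if_neg (by omega), max_eq_left (by omega)]
      simp
    · have hx : ((splitLast α m).symm (Sum.inr a)).1.val = m := rfl
      have hy : ((splitLast α m).symm (Sum.inr b)).1.val = m := rfl
      rw [SimpleGraph.sum_adj]
      simp only [Fin.ext_iff, hx, hy]
      simp [Nat.even_iff]
      omega

/-- The row of the eigenvalue equation at a vertex `⟨i, a⟩`, in terms of cell sums. -/
lemma adjMat_cographC_mulVec (α : ℕ → ℕ) (k : ℕ) (v : (Σ j : Fin (2 * k), Fin (α j.val)) → ℝ)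
    (i : Fin (2 * k)) (a : Fin (α i.val)) :
    (adjMat (cographC α (2 * k)) *ᵥ v) ⟨i, a⟩ =
      (if Even i.val then (∑ b, v ⟨i, b⟩) - v ⟨i, a⟩ else 0) +
        ∑ j, if j ≠ i ∧ Odd (max i.val j.val) then ∑ b, v ⟨j, b⟩ else 0 := by
  have hcell : ∀ j : Fin (2 * k),
      ∑ b, adjMat (cographC α (2 * k)) ⟨i, a⟩ ⟨j, b⟩ * v ⟨j, b⟩ =
        (if j = i then (if Even i.val then (∑ b, v ⟨i, b⟩) - v ⟨i, a⟩ else 0) else 0) +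
          if j ≠ i ∧ Odd (max i.val j.val) then ∑ b, v ⟨j, b⟩ else 0 := by
    intro j
    by_cases hj : j = i
    · subst hj
      simp only [adjMat, of_apply, cographC_adj_iff, Nat.even_add]
      by_cases he : Even j.val
      · have : ∀ b, (if a ≠ b then (1 : ℝ) else 0) * v ⟨j, b⟩ =
            v ⟨j, b⟩ - if a = b then v ⟨j, b⟩ else 0 := by
          intro b; split_ifs <;> simp_all
        simp only [he]
        simp
        simpa using Finset.sum_congr rfl (fun b (_ : b ∈ Finset.univ) => this b)
      · simp [he]
    · have hne : ∀ b, (⟨i, a⟩ : Σ j : Fin (2 * k), Fin (α j.val)) ≠ ⟨j, b⟩ := by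
        intro b h
        exact hj (congrArg Sigma.fst h).symm
      have hij : i ≠ j := fun h => hj h.symm
      simp only [adjMat, of_apply, cographC_adj_iff]
      by_cases ho : Odd (max i.val j.val)
      · have ho' : Odd (2 * k + max i.val j.val) := by grind
        simp [hj, hij, ho, ho', hne]
      · have ho' : ¬ Odd (2 * k + max i.val j.val) := by grind
        simp [hj, hij, ho, ho']
  simp only [mulVec, dotProduct]
  rw [Fintype.sum_sigma, Finset.sum_congr rfl fun j _ => hcell j, Finset.sum_add_distrib]
  simp

/-- An eigenvector for an eigenvalue other than `0` and `-1` yields a nonzero solution of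
a linear recurrence with boundary conditions. -/
lemma exists_recurrence_of_isRoot (k : ℕ) (α : ℕ → ℕ) (lam : ℝ) (h0 : lam ≠ 0) (h1 : lam + 1 ≠ 0)
    (hlam : (adjMat (cographC α (2 * k))).charpoly.IsRoot lam) :
    ∃ w t u : ℕ → ℝ, (∃ i < 2 * k, t i ≠ 0 ∨ u i ≠ 0 ∨ w i ≠ 0) ∧ u 0 = t 0 ∧ t (2 * k) = 0 ∧
      ∀ n < k, (lam + 1 - α (2 * n)) * w (2 * n) = α (2 * n) * t (2 * n) ∧
        u (2 * n + 1) = u (2 * n) + w (2 * n) ∧ t (2 * n + 1) = t (2 * n) ∧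
        (lam + α (2 * n + 1)) * w (2 * n + 1) = α (2 * n + 1) * u (2 * n + 1) ∧
        u (2 * n + 2) = u (2 * n + 1) ∧ t (2 * n + 2) = t (2 * n + 1) - w (2 * n + 1) := by
  obtain ⟨v, hv, hAv⟩ : ∃ v, v ≠ 0 ∧ adjMat (cographC α (2 * k)) *ᵥ v = lam • v := by
    rw [Polynomial.IsRoot, Matrix.eval_charpoly] at hlam
    obtain ⟨v, hv, h⟩ := Matrix.exists_mulVec_eq_zero_iff.mpr hlam
    refine ⟨v, hv, ?_⟩
    rw [Matrix.sub_mulVec, sub_eq_zero] at h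
    rw [← h]
    simp [← Matrix.smul_one_eq_diagonal, Matrix.smul_mulVec]
  let W : Fin (2 * k) → ℝ := fun i => ∑ b, v ⟨i, b⟩
  let w : ℕ → ℝ := fun i => if h : i < 2 * k then W ⟨i, h⟩ else 0
  let t : ℕ → ℝ := fun i => ∑ l : Fin (2 * k), if i ≤ l.val ∧ Odd l.val then W l else 0
  let s : ℕ → ℝ := fun i => ∑ l : Fin (2 * k), if l.val < i then W l else 0
  have hw : ∀ i : Fin (2 * k), w i.val = W i := fun i => by simp [w]
  have hs : ∀ i : Fin (2 * k), s (i.val + 1) = s i.val + W i := by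
    intro i
    have : W i = ∑ l, if l = i then W l else 0 := by simp
    rw [this, ← Finset.sum_add_distrib]
    refine Finset.sum_congr rfl fun l _ => ?_
    simp only [Fin.ext_iff]
    split_ifs <;> first | omega | simp
  have ht : ∀ i : Fin (2 * k), t i.val = t (i.val + 1) + if Odd i.val then W i else 0 := by
    intro i
    have : (if Odd i.val then W i else 0) =
        ∑ l, if l = i then (if Odd l.val then W l else 0) else 0 := by simp
    rw [this, ← Finset.sum_add_distrib]
    refine Finset.sum_congr rfl fun l _ => ?_
    simp only [Fin.ext_iff]
    by_cases ho : Odd l.val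
    · simp only [ho, and_true, if_true]
      split_ifs <;> first | omega | simp
    · simp [ho]
  have heven : ∀ i : Fin (2 * k), Even i.val → ∀ a, (lam + 1) * v ⟨i, a⟩ = W i + t i.val := by
    intro i hi a
    have h := congrFun hAv ⟨i, a⟩
    rw [adjMat_cographC_mulVec, if_pos hi] at h
    have : (∑ j, if j ≠ i ∧ Odd (max i.val j.val) then ∑ b, v ⟨j, b⟩ else 0) = t i.val := by
      refine Finset.sum_congr rfl fun l _ => ?_
      have : (l ≠ i ∧ Odd (max i.val l.val)) ↔ (i.val ≤ l.val ∧ Odd l.val) := by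
        rw [ne_eq, Fin.ext_iff]
        grind
      simp only [this, W]
    rw [this] at h
    simp only [Pi.smul_apply, smul_eq_mul] at h
    simp only [W]
    linarith
  have hodd : ∀ i : Fin (2 * k), Odd i.val → ∀ a, lam * v ⟨i, a⟩ = s i.val + t i.val - W i := by
    intro i hi a
    have h := congrFun hAv ⟨i, a⟩
    rw [adjMat_cographC_mulVec, if_neg (Nat.not_even_iff_odd.mpr hi)] at h
    have : (∑ j, if j ≠ i ∧ Odd (max i.val j.val) then ∑ b, v ⟨j, b⟩ else 0) =
        s i.val + t (i.val + 1) := by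
      rw [← Finset.sum_add_distrib]
      refine Finset.sum_congr rfl fun l _ => ?_
      simp only [ne_eq, Fin.ext_iff, W]
      grind
    rw [this] at h
    simp only [Pi.smul_apply, smul_eq_mul] at h
    have := ht i
    rw [if_pos hi] at this
    linarith
  refine ⟨w, t, fun i => s i + t i, ?_, ?_, ?_, ?_⟩
  · by_contra! hcon
    apply hv
    ext ⟨i, a⟩
    obtain ⟨hti, hui, hwi⟩ := hcon i i.isLt
    rw [hw] at hwi
    rcases Nat.even_or_odd i.val with hi | hi
    · have := heven i hi a
      rw [hti, hwi, add_zero] at this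
      exact (mul_eq_zero.mp this).resolve_left h1
    · have := hodd i hi a
      rw [hui, hwi, sub_zero] at this
      exact (mul_eq_zero.mp this).resolve_left h0
  · simp [s]
  · refine Finset.sum_eq_zero fun l _ => if_neg ?_
    have := l.isLt
    omega
  · intro n hn
    let i : Fin (2 * k) := ⟨2 * n, by omega⟩
    let j : Fin (2 * k) := ⟨2 * n + 1, by omega⟩
    have hi : Even i.val := even_two_mul n
    have hj : Odd j.val := odd_two_mul_add_one n
    have hti := ht i
    have htj := ht j
    have hsi := hs i
    have hsj := hs j
    have hwi := hw i
    have hwj := hw j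
    rw [if_neg (Nat.not_odd_iff_even.mpr hi), add_zero] at hti
    rw [if_pos hj] at htj
    have hWi := Finset.sum_congr rfl fun a (_ : a ∈ Finset.univ) => heven i hi a
    have hWj := Finset.sum_congr rfl fun a (_ : a ∈ Finset.univ) => hodd j hj a
    rw [← Finset.mul_sum] at hWi hWj
    simp only [Finset.sum_const, Finset.card_univ, Fintype.card_fin, nsmul_eq_mul] at hWi hWj
    change (lam + 1) * W i = _ at hWi
    change lam * W j = _ at hWj
    simp only [i, j, add_assoc, Nat.reduceAdd] at *
    refine ⟨?_, ?_, ?_, ?_, ?_, ?_⟩ <;> simp only [hwi, hwj, hsi, hsj, hti, htj] at * <;> linarith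

/-- If the denominators do not vanish and the ratio `u / t` stays in a region `P` along double
steps, then `t` cannot vanish at the end, so `lam` is not an eigenvalue. -/
lemma not_isRoot_of_ratio_invariant (k : ℕ) (α : ℕ → ℕ) (lam : ℝ) (h0 : lam ≠ 0)
    (h1 : lam + 1 ≠ 0) (P : ℝ → Prop) (hP : P 1)
    (hden : ∀ i < 2 * k, lam + 1 - α i ≠ 0 ∧ lam + α i ≠ 0)
    (hstep : ∀ i < 2 * k, ∀ j < 2 * k, ∀ q, P q →
      1 - α j / (lam + α j) * (q + α i / (lam + 1 - α i)) ≠ 0 ∧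
      P ((q + α i / (lam + 1 - α i)) /
        (1 - α j / (lam + α j) * (q + α i / (lam + 1 - α i))))) :
    ¬ (adjMat (cographC α (2 * k))).charpoly.IsRoot lam := by
  intro hlam
  obtain ⟨w, t, u, ⟨i, hi, hne⟩, hu0, htk, hrec⟩ :=
    exists_recurrence_of_isRoot k α lam h0 h1 hlam
  by_cases ht0 : t 0 = 0
  · have hz : ∀ n ≤ k, t (2 * n) = 0 ∧ u (2 * n) = 0 := by
      intro n
      induction n with
      | zero => exact fun _ => ⟨ht0, hu0.trans ht0⟩
      | succ n ih =>
        intro hn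
        obtain ⟨htn, hun⟩ := ih (by omega)
        obtain ⟨e1, e2, e3, e4, e5, e6⟩ := hrec n (by omega)
        have hw1 : w (2 * n) = 0 := by
          rw [htn, mul_zero] at e1
          exact (mul_eq_zero.mp e1).resolve_left (hden _ (by omega)).1
        have hu1 : u (2 * n + 1) = 0 := by rw [e2, hun, hw1, add_zero]
        have hw2 : w (2 * n + 1) = 0 := by
          rw [hu1, mul_zero] at e4
          exact (mul_eq_zero.mp e4).resolve_left (hden _ (by omega)).2
        refine ⟨?_, ?_⟩
        · rw [mul_add, mul_one, e6, e3, htn, hw2, sub_zero]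
        · rw [mul_add, mul_one, e5, hu1]
    obtain ⟨htn, hun⟩ := hz (i / 2) (by omega)
    obtain ⟨e1, e2, e3, e4, -, -⟩ := hrec (i / 2) (by omega)
    have hw1 : w (2 * (i / 2)) = 0 := by
      rw [htn, mul_zero] at e1
      exact (mul_eq_zero.mp e1).resolve_left (hden _ (by omega)).1
    have hu1 : u (2 * (i / 2) + 1) = 0 := by rw [e2, hun, hw1, add_zero]
    have hw2 : w (2 * (i / 2) + 1) = 0 := by
      rw [hu1, mul_zero] at e4
      exact (mul_eq_zero.mp e4).resolve_left (hden _ (by omega)).2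
    rw [htn] at e3
    rcases Nat.even_or_odd' i with ⟨c, rfl | rfl⟩
    · rw [show 2 * c / 2 = c by omega] at *
      simp_all
    · rw [show (2 * c + 1) / 2 = c by omega] at *
      simp_all
  · have hz : ∀ n ≤ k, t (2 * n) ≠ 0 ∧ ∃ q, P q ∧ u (2 * n) = q * t (2 * n) := by
      intro n
      induction n with
      | zero => exact fun _ => ⟨ht0, 1, hP, by rw [one_mul]; exact hu0⟩
      | succ n ih =>
        intro hn
        obtain ⟨htn, q, hq, hun⟩ := ih (by omega)
        obtain ⟨e1, e2, e3, e4, e5, e6⟩ := hrec n (by omega)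
        obtain ⟨hne, hq'⟩ := hstep (2 * n) (by omega) (2 * n + 1) (by omega) q hq
        have hd1 := (hden (2 * n) (by omega)).1
        have hd2 := (hden (2 * n + 1) (by omega)).2
        set a : ℝ := α (2 * n) / (lam + 1 - α (2 * n)) with ha
        set b : ℝ := α (2 * n + 1) / (lam + α (2 * n + 1)) with hb
        have hw1 : w (2 * n) = a * t (2 * n) := by
          rw [ha, div_mul_eq_mul_div, eq_div_iff hd1, ← e1, mul_comm]
        have hu1 : u (2 * n + 1) = (q + a) * t (2 * n) := by rw [e2, hun, hw1]; ring
        have hw2 : w (2 * n + 1) = b * u (2 * n + 1) := by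
          rw [hb, div_mul_eq_mul_div, eq_div_iff hd2, ← e4, mul_comm]
        have ht2 : t (2 * (n + 1)) = (1 - b * (q + a)) * t (2 * n) := by
          rw [mul_add, mul_one, e6, e3, hw2, hu1]; ring
        refine ⟨ht2 ▸ mul_ne_zero hne htn, _, hq', ?_⟩
        rw [ht2, ← mul_assoc, div_mul_cancel₀ _ hne, mul_add, mul_one, e5, hu1]
    exact (hz k le_rfl).1 htk

/-- One double step of the recurrence for `lam = -1 - δ` slightly below `-1`. -/
lemma ratio_bounds_of_neg {δ d q a b : ℝ} (hδ : 0 < δ) (hd : d * (1 + δ) = 1) (h4 : 4 * δ ≤ d)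
    (hq : q = 1 ∨ (-1 ≤ q ∧ q ≤ d / 2)) (ha : -1 < a) (ha' : a ≤ -d)
    (hb : b * δ = -1 ∨ (1 ≤ b ∧ b * (1 - δ) ≤ 2)) :
    1 - b * (q + a) ≠ 0 ∧ -1 ≤ (q + a) / (1 - b * (q + a)) ∧
      (q + a) / (1 - b * (q + a)) ≤ d / 2 := by
  have hd0 : 0 < d := by nlinarith
  have hd1 : d < 1 := by nlinarith
  have hp : (0 < q + a ∧ q + a ≤ δ * d) ∨ (-2 ≤ q + a ∧ q + a ≤ -(d / 2)) := by
    rcases hq with rfl | ⟨h, h'⟩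
    · left; constructor <;> nlinarith
    · right; constructor <;> linarith
  set p := q + a
  rcases hp with ⟨h, h'⟩ | ⟨h, h'⟩
  · have key : 2 * p ≤ d * (1 - b * p) := by
      rcases hb with hb | ⟨hb, hb'⟩
      · have : b < 0 := by nlinarith
        have := mul_neg_of_neg_of_pos this h
        nlinarith
      · have hb3 : b ≤ 3 := by nlinarith
        have hpd : p ≤ δ := by nlinarith
        have : b * p ≤ 3 * δ := by nlinarith
        nlinarith
    have hpos : 0 < 1 - b * p := by
      by_contra! hc
      nlinarith
    refine ⟨hpos.ne', ?_, ?_⟩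
    · have := div_pos h hpos
      linarith
    · rw [div_le_iff₀ hpos]
      linarith
  · have hp0 : p < 0 := by linarith
    rcases hb with hb | ⟨hb, hb'⟩
    · have hbp : b * p * δ = -p := by linear_combination p * hb
      have hneg : 1 - b * p < 0 := by
        by_contra! hc
        nlinarith
      refine ⟨hneg.ne, ?_, ?_⟩
      · have := div_pos_of_neg_of_neg hp0 hneg
        linarith
      · rw [div_le_iff_of_neg hneg]
        have hmul : δ * (d / 2 * (1 - b * p)) ≤ δ * p := by
          nlinarith
        exact le_of_mul_le_mul_left hmul hδ
    · have hpos : 0 < 1 - b * p := by nlinarith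
      refine ⟨hpos.ne', ?_, ?_⟩
      · rw [le_div_iff₀ hpos]
        nlinarith
      · have := div_neg_of_neg_of_pos hp0 hpos
        linarith

/-- One double step of the recurrence for small positive `lam`. -/
lemma ratio_bounds_of_pos {d q a b : ℝ} (hd : 0 < d) (hq : -2 / d ≤ q) (hq1 : q ≤ 1)
    (ha : a < -1 ∨ 4 / d ≤ a) (hb : d ≤ b) :
    1 - b * (q + a) ≠ 0 ∧ -2 / d ≤ (q + a) / (1 - b * (q + a)) ∧
      (q + a) / (1 - b * (q + a)) ≤ 1 := by
  have hinv : -2 / d * d = -2 := div_mul_cancel₀ _ hd.ne'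
  have hinv4 : 4 / d * d = 4 := div_mul_cancel₀ _ hd.ne'
  have hp : q + a < 0 ∨ 2 ≤ (q + a) * d := by
    rcases ha with ha | ha
    · left; linarith
    · right; nlinarith
  set p := q + a
  have hneg2 : -2 / d < 0 := by
    by_contra! hc
    nlinarith
  rcases hp with hp | hp
  · have hpos : 0 < 1 - b * p := by nlinarith
    have hquot := div_neg_of_neg_of_pos hp hpos
    refine ⟨hpos.ne', ?_, by linarith⟩
    rw [div_le_div_iff₀ hd hpos]
    nlinarith [mul_nonneg (sub_nonneg.mpr hb) (neg_pos.mpr hp).le]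
  · have hp0 : 0 < p := by
      by_contra! hc
      nlinarith
    have hbp : d * p ≤ b * p := by gcongr
    have hneg : 1 - b * p < 0 := by nlinarith
    have hquot := div_neg_of_pos_of_neg hp0 hneg
    refine ⟨hneg.ne, ?_, by linarith⟩
    rw [le_div_iff_of_neg hneg]
    have hmul : p * d ≤ -2 / d * (1 - b * p) * d := by
      nlinarith
    exact le_of_mul_le_mul_right hmul hd

/-- for `G = C(α_1,…,α_{2k})`, every eigenvalue `λ < -1` satisfies
`λ < (-1-√2)/2`, and every eigenvalue `λ > 0` satisfies `λ > ((-1+√2)/2)·α_min`. -/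
theorem stmt14 (k : ℕ) (hk : 1 ≤ k) (α : ℕ → ℕ) (hα : ∀ i < 2 * k, 0 < α i) (lam : ℝ)
    (hlam : (adjMat (cographC α (2 * k))).charpoly.IsRoot lam) :
    (lam < -1 → lam < (-1 - Real.sqrt 2) / 2) ∧
      (0 < lam →
        ((-1 + Real.sqrt 2) / 2) *
            (((Finset.range (2 * k)).inf'
              (Finset.nonempty_range_iff.mpr (by omega)) α : ℕ) : ℝ) < lam) := by
  have hsq : Real.sqrt 2 ^ 2 = 2 := Real.sq_sqrt (by norm_num)
  have hs0 : 0 ≤ Real.sqrt 2 := Real.sqrt_nonneg 2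
  have hα1 : ∀ i < 2 * k, (1 : ℝ) ≤ α i := fun i hi => by exact_mod_cast hα i hi
  have hα2 : ∀ i < 2 * k, (α i : ℝ) = 1 ∨ (2 : ℝ) ≤ α i := by
    intro i hi
    rcases (Nat.succ_le_iff.mpr (hα i hi)).eq_or_lt with h | h
    · left; exact_mod_cast h.symm
    · right; exact_mod_cast h
  constructor
  · intro hlt
    by_contra! hge
    obtain ⟨δ, rfl⟩ : ∃ δ, lam = -1 - δ := ⟨-1 - lam, by ring⟩
    have hδ : 0 < δ := by linarith
    have h4 : 4 * δ * (1 + δ) ≤ 1 := by nlinarith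
    have hδ4 : δ < 1 / 4 := by nlinarith
    have hd : 1 / (1 + δ) * (1 + δ) = 1 := by field_simp
    have hden : ∀ i < 2 * k, -1 - δ + 1 - (α i : ℝ) ≠ 0 ∧ -1 - δ + (α i : ℝ) ≠ 0 := by
      intro i hi
      refine ⟨by linarith [hα1 i hi], ?_⟩
      rcases hα2 i hi with h | h
      · rw [h]; linarith
      · linarith
    refine not_isRoot_of_ratio_invariant k α (-1 - δ) (by linarith) (by linarith)
      (fun q => q = 1 ∨ (-1 ≤ q ∧ q ≤ 1 / (1 + δ) / 2)) (Or.inl rfl) hden ?_ hlam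
    intro i hi j hj q hq
    have hi1 := hα1 i hi
    refine (fun h => ⟨h.1, Or.inr h.2⟩) (ratio_bounds_of_neg hδ hd ?_ hq ?_ ?_ ?_)
    · rwa [le_div_iff₀ (by linarith)]
    · rw [lt_div_iff_of_neg (by linarith)]
      linarith
    · rw [div_le_iff_of_neg (by linarith), neg_mul, div_mul_eq_mul_div, ← neg_div,
        div_le_iff₀ (by linarith)]
      nlinarith
    · rcases hα2 j hj with h | h
      · left
        rw [h, div_mul_eq_mul_div, div_eq_iff (by linarith)]
        ring
      · right
        constructor
        · rw [le_div_iff₀ (by linarith)]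
          linarith
        · rw [div_mul_eq_mul_div, div_le_iff₀ (by linarith)]
          nlinarith
  · intro hpos
    by_contra! hle
    have hne := Finset.nonempty_range_iff.mpr (show 2 * k ≠ 0 by omega)
    obtain ⟨i₀, hi₀, hmin⟩ := Finset.exists_mem_eq_inf' hne α
    have hcα : ∀ i < 2 * k, (((Finset.range (2 * k)).inf' hne α : ℕ) : ℝ) ≤ α i := fun i hi => by
      exact_mod_cast Finset.inf'_le α (Finset.mem_range.mpr hi)
    have hc1 : (1 : ℝ) ≤ (((Finset.range (2 * k)).inf' hne α : ℕ) : ℝ) := by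
      rw [hmin]
      exact hα1 i₀ (Finset.mem_range.mp hi₀)
    set c : ℝ := (((Finset.range (2 * k)).inf' hne α : ℕ) : ℝ)
    have h4 : 4 * lam * (lam + c) ≤ c ^ 2 := by
      have h : 2 * lam + c ≤ Real.sqrt 2 * c := by linarith
      nlinarith [mul_self_le_mul_self (by linarith) h]
    have hlc : lam < c / 4 := by nlinarith
    have hd : 0 < c / (lam + c) := by positivity
    have hden : ∀ i < 2 * k, lam + 1 - (α i : ℝ) ≠ 0 ∧ lam + (α i : ℝ) ≠ 0 := by
      intro i hi
      have := hcα i hi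
      refine ⟨?_, by linarith⟩
      rcases hα2 i hi with h | h
      · rw [h]; linarith
      · linarith
    refine not_isRoot_of_ratio_invariant k α lam hpos.ne' (by linarith)
      (fun q => -2 / (c / (lam + c)) ≤ q ∧ q ≤ 1)
      ⟨(div_nonpos_of_nonpos_of_nonneg (by norm_num) hd.le).trans zero_le_one, le_rfl⟩ hden ?_ hlam
    intro i hi j hj q hq
    have hci := hcα i hi
    have hcj := hcα j hj
    refine ratio_bounds_of_pos hd hq.1 hq.2 ?_ ?_
    · rcases hα2 i hi with h | h
      · right
        have hc : c = 1 := by linarith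
        rw [h, hc, div_div_eq_mul_div, div_one, le_div_iff₀ (by linarith)]
        rw [hc] at h4
        linarith
      · left
        rw [div_lt_iff_of_neg (by linarith)]
        linarith
    · rw [div_le_div_iff₀ (by linarith) (by linarith)]
      nlinarith
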